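/- Closed games are universally unravelable: if P is closed in [T], then for every covering (π, φ) : T' → T, the game (T', [π]^{-1}(P)) is unravelable. -/

import Mathlib

universe u

namespace GS

variable {A B C : Type u}

/-- A tree on `A`: a set of finite sequences closed under prefixes. -/
def IsTree (T : Set (List A)) : Prop := ∀ ⦃x y : List A⦄, x <+: y → y ∈ T → x ∈ T

/-- A tree is pruned if every node has a proper extension in the tree. -/
def IsPruned (T : Set (List A)) : Prop := ∀ x ∈ T, ∃ a : A, x ++ [a] ∈ T

/-- The body of a tree: infinite sequences all of whose finite prefixes lie in the tree. -/
def body (T : Set (List A)) : Set (ℕ → A) :=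
  {a | ∀ n : ℕ, (List.ofFn fun i : Fin n => a i) ∈ T}

/-- The product of the discrete topologies on `ℕ → A`. -/
def seqTop (A : Type u) : TopologicalSpace (ℕ → A) :=
  @Pi.topologicalSpace ℕ (fun _ => A) (fun _ => ⊥)

/-- The subspace topology on the body of a tree. -/
def bodyTop (T : Set (List A)) : TopologicalSpace {a // a ∈ body T} :=
  TopologicalSpace.induced Subtype.val (seqTop A)

/-- A (functional) strategy for player `i` on the tree `T`: to each position of player `i`
(i.e. of length `≡ i (mod 2)`) in `T` it assigns a legal move. -/
structure Strategy (T : Set (List A)) (i : ℕ) where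
  move : List A → A
  legal : ∀ x ∈ T, x.length % 2 = i % 2 → x ++ [move x] ∈ T

/-- A play is consistent with a strategy of player `i` if all moves of player `i` are
given by the strategy. -/
def Consistent {T : Set (List A)} {i : ℕ} (σ : Strategy T i) (a : ℕ → A) : Prop :=
  ∀ n : ℕ, n % 2 = i % 2 → a n = σ.move (List.ofFn fun j : Fin n => a j)

/-- The plays (branches of the tree) consistent with a strategy; this is the body `[σ]`
of the strategy tree of `σ`. -/
def plays {T : Set (List A)} {i : ℕ} (σ : Strategy T i) : Set (ℕ → A) :=
  {a ∈ body T | Consistent σ a}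

/-- A strategy of player `i` is winning in the game `(T, P)` if every play consistent with it
is won by player `i`. -/
def WinningStrategy (T : Set (List A)) (P : Set (ℕ → A)) {i : ℕ} (σ : Strategy T i) : Prop :=
  ∀ a ∈ plays σ, if i % 2 = 0 then a ∈ P else a ∉ P

/-- A game is determined if one of the two players has a winning strategy. -/
def Determined (T : Set (List A)) (P : Set (ℕ → A)) : Prop :=
  (∃ σ : Strategy T 0, WinningStrategy T P σ) ∨ ∃ σ : Strategy T 1, WinningStrategy T P σ

/-- The strategy tree of a functional strategy: all positions reachable while player `i`
follows `σ`. -/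
def stratTree (T : Set (List A)) (i : ℕ) (σ : Strategy T i) : Set (List A) :=
  {x ∈ T | ∀ (y : List A) (a : A), y ++ [a] <+: x → y.length % 2 = i % 2 → a = σ.move y}

/-- A morphism of trees: an isotone, length-preserving map. -/
structure TreeHom (S : Set (List A)) (T : Set (List B)) where
  toFun : List A → List B
  mem : ∀ x ∈ S, toFun x ∈ T
  len : ∀ x ∈ S, (toFun x).length = x.length
  mono : ∀ ⦃x y : List A⦄, x ∈ S → y ∈ S → x <+: y → toFun x <+: toFun y

/-- The identity tree morphism. -/
def TreeHom.id (S : Set (List A)) : TreeHom S S where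
  toFun := _root_.id
  mem _ hx := hx
  len _ _ := rfl
  mono _ _ _ _ h := h

/-- Composition of tree morphisms. -/
def TreeHom.comp {S : Set (List A)} {T : Set (List B)} {U : Set (List C)}
    (g : TreeHom T U) (f : TreeHom S T) : TreeHom S U where
  toFun := g.toFun ∘ f.toFun
  mem x hx := g.mem _ (f.mem x hx)
  len x hx := by simp only [Function.comp_apply, g.len _ (f.mem x hx), f.len x hx]
  mono x y hx hy hxy := g.mono (f.mem x hx) (f.mem y hy) (f.mono hx hy hxy)

/-- The map induced on infinite branches by a length-preserving isotone map of trees. -/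
def bodyMap [Inhabited B] (f : List A → List B) (a : ℕ → A) : ℕ → B :=
  fun n => (f (List.ofFn fun i : Fin (n + 1) => a i)).getD n default

/-- A covering of trees: a tree morphism `π` together with a map `φ` of strategies (of either
player) satisfying the locality condition and the branch lifting condition. -/
structure Covering [Inhabited A] (S : Set (List B)) (T : Set (List A)) where
  π : TreeHom S T
  φ : ∀ i : ℕ, Strategy S i → Strategy T i
  agree : ∀ (i n : ℕ) (σ σ' : Strategy S i),
    (∀ x ∈ S, x.length ≤ n → σ.move x = σ'.move x) →
    ∀ x ∈ T, x.length ≤ n → (φ i σ).move x = (φ i σ').move x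
  lift : ∀ (i : ℕ) (σ : Strategy S i), ∀ a ∈ plays (φ i σ),
    ∃ a' ∈ plays σ, bodyMap π.toFun a' = a

/-- A covering is `k`-fixing if `π` restricts to a bijection on the first `k` levels and `φ` is
induced by `π` there. -/
structure IsFixing [Inhabited A] {S : Set (List B)} {T : Set (List A)} (k : ℕ)
    (c : Covering S T) : Prop where
  bij : Function.Bijective fun x : {x : List B // x ∈ S ∧ x.length ≤ k} =>
    (⟨c.π.toFun x.1, c.π.mem _ x.2.1, by rw [c.π.len _ x.2.1]; exact x.2.2⟩ :
      {x : List A // x ∈ T ∧ x.length ≤ k})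
  induced : ∀ (i : ℕ) (σ : Strategy S i), ∀ x ∈ S, x.length < k → x.length % 2 = i % 2 →
    c.π.toFun (x ++ [σ.move x]) = c.π.toFun x ++ [(c.φ i σ).move (c.π.toFun x)]

/-- A game `(T, P)` is unravelable if for every `k` there is a `k`-fixing covering of `T` such
that the preimage of `P` is clopen in the body of the covering tree. -/
def Unravelable [Inhabited A] (T : Set (List A)) (P : Set (ℕ → A)) : Prop :=
  ∀ k : ℕ, ∃ (B : Type u) (S : Set (List B)) (c : Covering S T),
    IsTree S ∧ IsPruned S ∧ S.Nonempty ∧ IsFixing k c ∧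
    @IsClopen _ (bodyTop S) {a : {a // a ∈ body S} | bodyMap c.π.toFun a.1 ∈ P}

/-- A game `(T, P)` is universally unravelable if for every covering of `T` the game with the
preimage of `P` as payoff set is unravelable. -/
def UnivUnravelable [Inhabited A] (T : Set (List A)) (P : Set (ℕ → A)) : Prop :=
  ∀ (B : Type u) (_ : Inhabited B) (S : Set (List B)) (c : Covering S T),
    IsTree S → IsPruned S → S.Nonempty →
    Unravelable S (bodyMap c.π.toFun ⁻¹' P)

end GS

namespace GS

section Sequences

variable {α β : Type*}

/-- The restriction of an infinite sequence to its first `n` entries. -/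
def res (a : ℕ → α) (n : ℕ) : List α := List.ofFn fun i : Fin n => a i

@[simp] lemma length_res (a : ℕ → α) (n : ℕ) : (res a n).length = n := by simp [res]

lemma res_succ (a : ℕ → α) (n : ℕ) : res a (n + 1) = res a n ++ [a n] := by
  simp only [res, List.ofFn_succ', List.concat_eq_append]
  rfl

lemma getElem_res (a : ℕ → α) {n i : ℕ} (h : i < (res a n).length) : (res a n)[i] = a i := by
  simp [res]

lemma take_res (a : ℕ → α) (n m : ℕ) : (res a n).take m = res a (min m n) := by
  apply List.ext_getElem
  · simp
  · intro i h₁ h₂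
    simp [res]

lemma take_res_of_le (a : ℕ → α) {n m : ℕ} (h : m ≤ n) : (res a n).take m = res a m := by
  rw [take_res, min_eq_left h]

lemma res_prefix (a : ℕ → α) {m n : ℕ} (h : m ≤ n) : res a m <+: res a n := by
  rw [← take_res_of_le a h]
  exact List.take_prefix _ _

lemma eq_res_of_prefix {a : ℕ → α} {n : ℕ} {y : List α} (h : y <+: res a n) :
    y = res a y.length := by
  have hl := h.length_le
  rw [length_res] at hl
  rw [List.prefix_iff_eq_take.1 h, take_res_of_le a hl, length_res]

lemma res_congr {a b : ℕ → α} {n : ℕ} : res a n = res b n ↔ ∀ i < n, a i = b i := by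
  constructor
  · intro h i hi
    have := congrArg (fun l => l[i]?) h
    simpa [res, hi] using this
  · intro h
    simp only [res]
    congr 1
    funext i
    exact h i i.2

lemma prefix_append_singleton {x y : List α} {a : α} (h : x <+: y ++ [a]) :
    x <+: y ∨ x = y ++ [a] := by
  rcases List.prefix_concat_iff.1 (by simpa using h) with h | h
  · right; simpa using h
  · left; exact h

end Sequences

section Forcing

variable {A : Type u}

lemma res_mem {R : Set (List A)} {a : ℕ → A} (ha : a ∈ body R) (n : ℕ) : res a n ∈ R := ha n

open Classical in
/-- The strategy that plays a given move whenever it is legal. -/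
noncomputable def Strategy.ofFun {R : Set (List A)} (hR : IsPruned R) (i : ℕ)
    (m : List A → A) : Strategy R i where
  move y := if y ++ [m y] ∈ R then m y else if h : ∃ a, y ++ [a] ∈ R then h.choose else m y
  legal y hy _ := by
    have h : ∃ a, y ++ [a] ∈ R := hR y hy
    split_ifs with h₁
    · exact h₁
    · exact h.choose_spec

lemma Strategy.ofFun_move {R : Set (List A)} (hR : IsPruned R) (i : ℕ) (m : List A → A)
    {y : List A} (h : y ++ [m y] ∈ R) : (Strategy.ofFun hR i m).move y = m y := by
  simp [Strategy.ofFun, h]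

lemma Strategy.ofFun_move_congr {R : Set (List A)} (hR : IsPruned R) (i : ℕ)
    {m m' : List A → A} {y : List A} (h : m y = m' y) :
    (Strategy.ofFun hR i m).move y = (Strategy.ofFun hR i m').move y := by
  unfold Strategy.ofFun
  dsimp only
  rw [h]

/-- Player `i` can force plays of `R` extending `y` to pass through `U`. -/
def Reach (R : Set (List A)) (i : ℕ) (U : Set (List A)) (y : List A) : Prop :=
  ∃ s : Strategy R i, ∀ a ∈ body R, res a y.length = y →
    (∀ n, y.length ≤ n → n % 2 = i % 2 → a n = s.move (res a n)) → ∃ n, res a n ∈ U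

variable {R U : Set (List A)} {i : ℕ}

lemma reach_of_mem [Inhabited A] (hR : IsPruned R) {y : List A} (hy : y ∈ U) : Reach R i U y :=
  ⟨Strategy.ofFun hR i fun _ => default, fun _ _ hay _ => ⟨y.length, hay.symm ▸ hy⟩⟩

lemma reach_of_own_move (hR : IsPruned R) {y : List A} {b : A} (hp : y.length % 2 = i % 2)
    (hy : y ++ [b] ∈ R) (h : Reach R i U (y ++ [b])) : Reach R i U y := by
  classical
  obtain ⟨s, hs⟩ := h
  refine ⟨Strategy.ofFun hR i (Function.update s.move y b), fun a ha hay hc => ?_⟩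
  have hb : a y.length = b := by
    rw [hc _ le_rfl hp, hay, Strategy.ofFun_move] <;> simp [hy]
  have hres : res a (y ++ [b]).length = y ++ [b] := by
    rw [List.length_append, List.length_singleton, res_succ, hay, hb]
  refine hs a ha hres fun n hn hnp => ?_
  have hne : res a n ≠ y := by
    intro h
    have := congrArg List.length h
    simp at this hn
    omega
  rw [hc n (by simp at hn; omega) hnp, Strategy.ofFun_move] <;>
    rw [Function.update_of_ne hne]
  exact s.legal _ (res_mem ha n) (by simpa using hnp)

lemma reach_of_opponent_moves [Inhabited A] (hR : IsPruned R) {y : List A}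
    (h : ∀ b, y ++ [b] ∈ R → Reach R i U (y ++ [b])) : Reach R i U y := by
  classical
  let F : List A → Strategy R i := fun w =>
    if h : Reach R i U w then h.choose else Strategy.ofFun hR i fun _ => default
  refine ⟨⟨fun z => (F (z.take (y.length + 1))).move z, fun z => (F _).legal z⟩,
    fun a ha hay hc => ?_⟩
  have hres : res a (y.length + 1) = y ++ [a y.length] := by rw [res_succ, hay]
  have hreach := h (a y.length) (hres ▸ res_mem ha _)
  refine hreach.choose_spec a ha (by simpa using hres) fun n hn hnp => ?_
  simp only [List.length_append, List.length_singleton] at hn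
  rw [hc n (by omega) hnp]
  simp only [take_res_of_le a hn, hres, F, dif_pos hreach]

open Classical in
/-- The move at `z` of a strategy that forces plays through `w` into `U`. -/
noncomputable def attackMove [Inhabited A] (R : Set (List A)) (i : ℕ) (U : Set (List A))
    (w z : List A) : A :=
  if h : Reach R i U w then h.choose.move z else default

lemma attackMove_legal [Inhabited A] {w z : List A} (h : Reach R i U w) (hz : z ∈ R)
    (hp : z.length % 2 = i % 2) : z ++ [attackMove R i U w z] ∈ R := by
  rw [attackMove, dif_pos h]
  exact h.choose.legal z hz hp

lemma exists_mem_of_attack [Inhabited A] {a : ℕ → A} (ha : a ∈ body R) {m : ℕ}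
    (h : Reach R i U (res a m))
    (hc : ∀ n, m ≤ n → n % 2 = i % 2 → a n = attackMove R i U (res a m) (res a n)) :
    ∃ n, res a n ∈ U := by
  refine h.choose_spec a ha (by simp) fun n hn hnp => ?_
  rw [hc n (by simpa using hn) hnp, attackMove, dif_pos h]

/-- `Q` is a quasistrategy of player `i` in `R` from the position `r` on. -/
structure IsQuasi (R Q : Set (List A)) (i : ℕ) (r : List A) : Prop where
  subset : Q ⊆ R
  tree : IsTree Q
  pruned : IsPruned Q
  root : r ∈ Q
  closed : ∀ y ∈ Q, r <+: y → y.length % 2 ≠ i % 2 → ∀ a, y ++ [a] ∈ R → y ++ [a] ∈ Q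

/-- The positions of `R` at which, from `r` on, player `i` could never force reaching `U`. -/
def safe (R : Set (List A)) (i : ℕ) (U : Set (List A)) (r : List A) : Set (List A) :=
  {y ∈ R | ∀ z, z <+: y → r <+: z → ¬ Reach R i U z}

lemma isQuasi_safe [Inhabited A] (ht : IsTree R) (hR : IsPruned R) {j : ℕ} (hij : j % 2 ≠ i % 2)
    {r : List A} (hr : r ∈ R) (hU : ¬ Reach R i U r) : IsQuasi R (safe R i U r) j r where
  subset := fun _ h => h.1
  tree := fun x y hxy hy => ⟨ht hxy hy.1, fun z hz => hy.2 z (hz.trans hxy)⟩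
  pruned := by
    intro y hy
    by_cases hry : r <+: y
    · by_cases hp : y.length % 2 = i % 2
      · obtain ⟨b, hb⟩ := hR y hy.1
        refine ⟨b, hb, fun z hz hrz => ?_⟩
        rcases prefix_append_singleton hz with hz | rfl
        · exact hy.2 z hz hrz
        · exact fun h => hy.2 y List.prefix_rfl hry (reach_of_own_move hR hp hb h)
      · by_contra! hcon
        refine hy.2 y List.prefix_rfl hry (reach_of_opponent_moves hR fun b hb => ?_)
        by_contra hn
        refine hcon b ⟨hb, fun z hz hrz => ?_⟩
        rcases prefix_append_singleton hz with hz | rfl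
        · exact hy.2 z hz hrz
        · exact hn
    · obtain ⟨b, hb⟩ := hR y hy.1
      refine ⟨b, hb, fun z hz hrz => ?_⟩
      rcases prefix_append_singleton hz with hz | rfl
      · exact hy.2 z hz hrz
      · rcases prefix_append_singleton hrz with h | rfl
        · exact absurd h hry
        · exact hU
  root := ⟨hr, fun z hz hrz => by
    rwa [List.IsPrefix.eq_of_length_le hz hrz.length_le]⟩
  closed := by
    intro y hy hry hp b hb
    refine ⟨hb, fun z hz hrz => ?_⟩
    rcases prefix_append_singleton hz with hz | rfl
    · exact hy.2 z hz hrz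
    · exact fun h => hy.2 y List.prefix_rfl hry (reach_of_own_move hR (by omega) hb h)

end Forcing

section UnravelTree

variable {A : Type u}

/-- The label attached to the `n`-th move: `l₀` for the move at `N`, `l₁` for the next one. -/
def lbl (N : ℕ) (l₀ l₁ : Set (List A)) (n : ℕ) : Set (List A) :=
  if n = N then l₀ else if n = N + 1 then l₁ else ∅

lemma lbl_left (N : ℕ) (l₀ l₁ : Set (List A)) : lbl N l₀ l₁ N = l₀ := by simp [lbl]

lemma lbl_right (N : ℕ) (l₀ l₁ : Set (List A)) : lbl N l₀ l₁ (N + 1) = l₁ := by simp [lbl]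

lemma lbl_other {N n : ℕ} (l₀ l₁ : Set (List A)) (h : n ≠ N) (h' : n ≠ N + 1) :
    lbl N l₀ l₁ n = ∅ := by simp [lbl, h, h']

/-- The position `y` with labels attached to its moves. -/
def lab (N : ℕ) (l₀ l₁ : Set (List A)) (y : List A) : List (A × Set (List A)) :=
  y.mapIdx fun n a => (a, lbl N l₀ l₁ n)

variable {N : ℕ} {l₀ l₁ l₀' l₁' : Set (List A)}

@[simp] lemma length_lab (y : List A) : (lab N l₀ l₁ y).length = y.length := by simp [lab]

@[simp] lemma map_fst_lab (y : List A) : (lab N l₀ l₁ y).map Prod.fst = y := by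
  apply List.ext_getElem <;> simp [lab]

lemma lab_append (y : List A) (a : A) :
    lab N l₀ l₁ (y ++ [a]) = lab N l₀ l₁ y ++ [(a, lbl N l₀ l₁ y.length)] := by
  simp [lab, List.mapIdx_append]

lemma take_lab (y : List A) (n : ℕ) : (lab N l₀ l₁ y).take n = lab N l₀ l₁ (y.take n) := by
  apply List.ext_getElem <;> simp [lab]

lemma lab_congr {y : List A} (h₀ : N < y.length → l₀ = l₀')
    (h₁ : N + 1 < y.length → l₁ = l₁') : lab N l₀ l₁ y = lab N l₀' l₁' y := by
  apply List.ext_getElem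
  · simp
  · intro n hn _
    simp only [length_lab] at hn
    simp only [lab, List.getElem_mapIdx, Prod.mk.injEq, true_and, lbl]
    split_ifs with h h'
    · exact h₀ (h ▸ hn)
    · exact h₁ (h' ▸ hn)
    · rfl

lemma lab_eq_iff {y y' : List A} : lab N l₀ l₁ y = lab N l₀' l₁' y' ↔
    y = y' ∧ (N < y.length → l₀ = l₀') ∧ (N + 1 < y.length → l₁ = l₁') := by
  constructor
  · intro h
    have hy : y = y' := by simpa using congrArg (List.map Prod.fst) h
    subst hy
    have key : ∀ n < y.length, lbl N l₀ l₁ n = lbl N l₀' l₁' n := by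
      intro n hn
      have := congrArg (fun l => l[n]?) h
      simpa [lab, hn] using this
    refine ⟨rfl, fun h => ?_, fun h => ?_⟩
    · simpa [lbl] using key _ h
    · simpa [lbl] using key _ h
  · rintro ⟨rfl, h₀, h₁⟩
    exact lab_congr h₀ h₁

/-- The positions of `T` comparable with `u`. -/
def cone (T : Set (List A)) (u : List A) : Set (List A) := {y ∈ T | y <+: u ∨ u <+: y}

/-- The legal labels `Λ` for player `1` at `q` after player `0` has chosen `Q`: the cone of a
position of `Q` outside `D`, or a quasistrategy in `Q` that stays in `D`. -/
def Legit (T D Q Λ : Set (List A)) (q : List A) : Prop :=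
  (∃ u ∈ Q, q <+: u ∧ u ∉ D ∧ Λ = cone T u) ∨ (IsQuasi Q Λ 1 q ∧ ∀ y ∈ Λ, q <+: y → y ∈ D)

/-- The labels `l₀`, `l₁` turn `y` into a position of the unraveling tree. -/
structure Good (T D : Set (List A)) (N : ℕ) (l₀ l₁ : Set (List A)) (y : List A) : Prop where
  mem : y ∈ T
  quasi : N < y.length → IsQuasi T l₀ 0 (y.take (N + 1))
  legit : N + 1 < y.length → Legit T D l₀ l₁ (y.take (N + 2))
  mem_right : N + 1 < y.length → y ∈ l₁

/-- The tree of the unraveling of a closed game. -/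
def unravelTree (T D : Set (List A)) (N : ℕ) : Set (List (A × Set (List A))) :=
  {x | ∃ l₀ l₁ y, x = lab N l₀ l₁ y ∧ Good T D N l₀ l₁ y}

variable {T D : Set (List A)}

lemma Good.congr {y : List A} (h : Good T D N l₀ l₁ y) (h₀ : N < y.length → l₀ = l₀')
    (h₁ : N + 1 < y.length → l₁ = l₁') : Good T D N l₀' l₁' y where
  mem := h.mem
  quasi hy := h₀ hy ▸ h.quasi hy
  legit hy := h₁ hy ▸ h₀ (by omega) ▸ h.legit hy
  mem_right hy := h₁ hy ▸ h.mem_right hy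

lemma lab_mem_unravelTree {y : List A} :
    lab N l₀ l₁ y ∈ unravelTree T D N ↔ Good T D N l₀ l₁ y := by
  constructor
  · rintro ⟨m₀, m₁, y', h, hg⟩
    obtain ⟨rfl, h₀, h₁⟩ := lab_eq_iff.1 h
    exact hg.congr (fun h => (h₀ h).symm) (fun h => (h₁ h).symm)
  · exact fun h => ⟨_, _, _, rfl, h⟩

lemma good_of_length_le {y : List A} (hy : y ∈ T) (hl : y.length ≤ N) : Good T D N l₀ l₁ y :=
  ⟨hy, fun h => absurd h (by omega), fun h => absurd h (by omega), fun h => absurd h (by omega)⟩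

lemma isTree_cone (hT : IsTree T) (u : List A) : IsTree (cone T u) := by
  rintro x y hxy ⟨hy, h | h⟩
  · exact ⟨hT hxy hy, Or.inl (hxy.trans h)⟩
  · exact ⟨hT hxy hy, List.prefix_or_prefix_of_prefix hxy h⟩

lemma isPruned_cone (hpr : IsPruned T) (hT : IsTree T) {u : List A} (hu : u ∈ T) :
    IsPruned (cone T u) := by
  rintro y ⟨hy, h⟩
  by_cases huy : u <+: y
  · obtain ⟨b, hb⟩ := hpr y hy
    exact ⟨b, hb, Or.inr (huy.trans (List.prefix_append _ _))⟩
  · obtain ⟨t, rfl⟩ := h.resolve_right huy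
    cases t with
    | nil => simp at huy
    | cons b t =>
      have : y ++ [b] <+: y ++ b :: t := ⟨t, by simp⟩
      exact ⟨b, hT this hu, Or.inl this⟩

lemma Legit.subset {Q Λ : Set (List A)} {q : List A} (h : Legit T D Q Λ q) (hQ : Q ⊆ T) :
    Λ ⊆ T := by
  rcases h with ⟨u, _, _, _, rfl⟩ | ⟨h, _⟩
  · exact fun _ h => h.1
  · exact h.subset.trans hQ

lemma Legit.tree {Q Λ : Set (List A)} {q : List A} (h : Legit T D Q Λ q) (hT : IsTree T) :
    IsTree Λ := by
  rcases h with ⟨u, _, _, _, rfl⟩ | ⟨h, _⟩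
  · exact isTree_cone hT u
  · exact h.tree

lemma Legit.pruned {Q Λ : Set (List A)} {q : List A} (h : Legit T D Q Λ q) (hQ : Q ⊆ T)
    (hT : IsTree T) (hpr : IsPruned T) : IsPruned Λ := by
  rcases h with ⟨u, hu, _, _, rfl⟩ | ⟨h, _⟩
  · exact isPruned_cone hpr hT (hQ hu)
  · exact h.pruned

lemma Legit.root {Q Λ : Set (List A)} {q : List A} (h : Legit T D Q Λ q) (hQ : Q ⊆ T)
    (hT : IsTree T) : q ∈ Λ := by
  rcases h with ⟨u, hu, hqu, _, rfl⟩ | ⟨h, _⟩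
  · exact ⟨hT hqu (hQ hu), Or.inl hqu⟩
  · exact h.root

lemma exists_legit {Q : Set (List A)} (hQt : IsTree Q) (hQp : IsPruned Q) {q : List A}
    (hq : q ∈ Q) : ∃ Λ, Legit T D Q Λ q := by
  by_cases h : ∃ u ∈ Q, q <+: u ∧ u ∉ D
  · obtain ⟨u, hu, hqu, hD⟩ := h
    exact ⟨_, Or.inl ⟨u, hu, hqu, hD, rfl⟩⟩
  · push Not at h
    exact ⟨Q, Or.inr ⟨⟨subset_rfl, hQt, hQp, hq, fun _ _ _ _ _ h => h⟩, h⟩⟩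

lemma isTree_unravelTree (hT : IsTree T) : IsTree (unravelTree T D N) := by
  rintro x _ hxy ⟨l₀, l₁, w, rfl, hg⟩
  rw [List.prefix_iff_eq_take.1 hxy, take_lab, lab_mem_unravelTree]
  set k := x.length
  refine ⟨hT (List.take_prefix _ _) hg.mem, fun h => ?_, fun h => ?_, fun h => ?_⟩ <;>
    simp only [List.length_take, lt_min_iff] at h
  · rw [List.take_take, min_eq_left (by omega)]
    exact hg.quasi h.2
  · rw [List.take_take, min_eq_left (by omega)]
    exact hg.legit h.2
  · exact (hg.legit h.2).tree hT (List.take_prefix _ _) (hg.mem_right h.2)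

lemma isPruned_unravelTree (hT : IsTree T) (hpr : IsPruned T) (hN : N % 2 = 0) :
    IsPruned (unravelTree T D N) := by
  rintro _ ⟨l₀, l₁, y, rfl, hg⟩
  suffices h : ∃ m₀ m₁ a, lab N m₀ m₁ y = lab N l₀ l₁ y ∧ Good T D N m₀ m₁ (y ++ [a]) by
    obtain ⟨m₀, m₁, a, he, h⟩ := h
    refine ⟨(a, lbl N m₀ m₁ y.length), ?_⟩
    rw [← he, ← lab_append]
    exact lab_mem_unravelTree.2 h
  rcases lt_trichotomy y.length N with hl | hl | hl
  · obtain ⟨a, ha⟩ := hpr y hg.mem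
    exact ⟨l₀, l₁, a, rfl, good_of_length_le ha (by simp; omega)⟩
  · obtain ⟨a, ha⟩ := hpr y hg.mem
    refine ⟨T, l₁, a, lab_congr (fun h => absurd h (by omega)) fun _ => rfl, ha, fun _ => ?_,
      fun h => absurd h (by simp; omega), fun h => absurd h (by simp; omega)⟩
    refine ⟨subset_rfl, hT, hpr, hT (List.take_prefix _ _) ha, fun _ _ _ _ _ h => h⟩
  · have hQ := hg.quasi hl
    rcases Nat.lt_or_ge (N + 1) y.length with hl' | hl'
    · obtain ⟨a, ha⟩ := (hg.legit hl').pruned hQ.subset hT hpr y (hg.mem_right hl')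
      refine ⟨l₀, l₁, a, rfl, (hg.legit hl').subset hQ.subset ha, fun _ => ?_, fun _ => ?_,
        fun _ => ha⟩
      · rwa [List.take_append_of_le_length (by omega)]
      · rw [List.take_append_of_le_length (by omega)]
        exact hg.legit hl'
    · have hy : y.take (N + 1) = y := List.take_of_length_le hl'
      rw [hy] at hQ
      obtain ⟨a, ha⟩ := hQ.pruned y hQ.root
      obtain ⟨Λ, hΛ⟩ := exists_legit (T := T) (D := D) hQ.tree hQ.pruned ha
      refine ⟨l₀, Λ, a, lab_congr (fun _ => rfl) fun h => absurd h (by omega),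
        hQ.subset ha, fun _ => ?_, fun _ => ?_, fun _ => hΛ.root hQ.subset hT⟩
      · rwa [List.take_append_of_le_length (by omega), hy]
      · rwa [List.take_of_length_le (by simp; omega)]

/-- A one-move extension of a labelled position is again a labelled position. -/
lemma exists_good_of_append_mem {y : List A} {m : A × Set (List A)}
    (h : lab N l₀ l₁ y ++ [m] ∈ unravelTree T D N) :
    ∃ l₀' l₁', Good T D N l₀' l₁' (y ++ [m.1]) ∧ m.2 = lbl N l₀' l₁' y.length ∧
      (N < y.length → l₀' = l₀) ∧ (N + 1 < y.length → l₁' = l₁) := by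
  obtain ⟨m₀, m₁, w, he, hg⟩ := h
  have hw : y ++ [m.1] = w := by simpa using congrArg (List.map Prod.fst) he
  subst hw
  rw [lab_append] at he
  obtain ⟨he, hm⟩ := List.append_inj' he rfl
  obtain ⟨-, h₀, h₁⟩ := lab_eq_iff.1 he
  simp only [List.cons.injEq, and_true] at hm
  exact ⟨m₀, m₁, hg, congrArg Prod.snd hm, fun h => (h₀ h).symm, fun h => (h₁ h).symm⟩

/-- The sequence `a` with labels attached to its moves. -/
def labSeq (N : ℕ) (l₀ l₁ : Set (List A)) (a : ℕ → A) : ℕ → A × Set (List A) :=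
  fun n => (a n, lbl N l₀ l₁ n)

lemma res_labSeq (a : ℕ → A) (n : ℕ) : res (labSeq N l₀ l₁ a) n = lab N l₀ l₁ (res a n) := by
  induction n with
  | zero => rfl
  | succ n ih => rw [res_succ, res_succ, ih, lab_append, length_res, labSeq]

lemma good_of_mem_body {a' : ℕ → A × Set (List A)}
    (h : a' ∈ body (unravelTree T D N)) :
    ∀ n, Good T D N (a' N).2 (a' (N + 1)).2 (res (fun n => (a' n).1) n) := by
  have key : ∀ n, res a' n = lab N (a' N).2 (a' (N + 1)).2 (res (fun n => (a' n).1) n) := by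
    intro n
    obtain ⟨l₀, l₁, y, he, -⟩ := res_mem h n
    have hy : res (fun n => (a' n).1) n = y := by
      have := congrArg (List.map Prod.fst) he
      rw [map_fst_lab] at this
      rw [← this]
      simp [res, List.map_ofFn, Function.comp_def]
    have hn : y.length = n := by rw [← hy, length_res]
    have hget : ∀ k < n, (a' k).2 = lbl N l₀ l₁ k := by
      intro k hk
      have := congrArg (fun l => l[k]?) he
      simp only [res, lab, List.getElem?_ofFn, hk, dif_pos, List.getElem?_mapIdx,
        List.getElem?_eq_getElem (hn ▸ hk : k < y.length), Option.map_some, Option.some.injEq]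
        at this
      rw [this]
    rw [he, hy]
    refine lab_congr (fun h => ?_) fun h => ?_
    · rw [hget _ (hn ▸ h), lbl_left]
    · rw [hget _ (hn ▸ h), lbl_right]
  exact fun n => lab_mem_unravelTree.1 (key n ▸ res_mem h n)

variable {i : ℕ} {σ : Strategy (unravelTree T D N) i} {a : ℕ → A}

lemma exists_good_move {y : List A} (h : Good T D N l₀ l₁ y) (hp : y.length % 2 = i % 2) :
    ∃ l₀' l₁', Good T D N l₀' l₁' (y ++ [(σ.move (lab N l₀ l₁ y)).1]) ∧
      (σ.move (lab N l₀ l₁ y)).2 = lbl N l₀' l₁' y.length ∧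
      (N < y.length → l₀' = l₀) ∧ (N + 1 < y.length → l₁' = l₁) :=
  exists_good_of_append_mem (σ.legal _ (lab_mem_unravelTree.2 h) (by simpa using hp))

lemma good_move {y : List A} (h : Good T D N l₀ l₁ y) (hp : y.length % 2 = i % 2)
    (hl : N + 1 < y.length) : Good T D N l₀ l₁ (y ++ [(σ.move (lab N l₀ l₁ y)).1]) := by
  obtain ⟨m₀, m₁, hg, -, h₀, h₁⟩ := exists_good_move (σ := σ) h hp
  exact hg.congr (fun _ => h₀ (by omega)) fun _ => h₁ hl

lemma good_res (ha : a ∈ body T) (hq : IsQuasi T l₀ 0 (res a (N + 1)))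
    (hl : Legit T D l₀ l₁ (res a (N + 2))) {n : ℕ} (hm : N + 1 < n → res a n ∈ l₁) :
    Good T D N l₀ l₁ (res a n) where
  mem := res_mem ha n
  quasi h := by
    rw [length_res] at h
    rwa [take_res_of_le a h]
  legit h := by
    rw [length_res] at h
    rwa [take_res_of_le a h]
  mem_right h := hm (by simpa using h)

lemma res_mem_cone (ha : a ∈ body T) (k n : ℕ) : res a n ∈ cone T (res a k) :=
  ⟨res_mem ha n, (le_total n k).imp (res_prefix a) (res_prefix a)⟩

/-- Before `u` is reached, moves legal with respect to the cone of `u` are forced. -/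
lemma move_eq_of_cone {k n : ℕ} (hg : Good T D N l₀ (cone T (res a k)) (res a n))
    (hN : N + 1 < n) (hnk : n < k) (hp : n % 2 = i % 2) :
    (σ.move (lab N l₀ (cone T (res a k)) (res a n))).1 = a n := by
  have h := (good_move (σ := σ) hg (by simpa using hp) (by simpa using hN)).mem_right
    (by simp; omega)
  have hpre : res a n ++ [(σ.move (lab N l₀ (cone T (res a k)) (res a n))).1] <+: res a k := by
    rcases h.2 with h | h
    · exact h
    · exact ⟨[], by simpa using (List.IsPrefix.eq_of_length_le h (by simp; omega)).symm⟩
  have := eq_res_of_prefix hpre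
  rw [List.length_append, length_res, List.length_singleton, res_succ] at this
  simpa using this

/-- A play whose labelling by `l₀`, `l₁` follows `σ` lifts. -/
lemma labSeq_mem_plays (hg : ∀ n, Good T D N l₀ l₁ (res a n))
    (hmove : ∀ n, n % 2 = i % 2 → (σ.move (lab N l₀ l₁ (res a n))).1 = a n)
    (h₀ : N % 2 = i % 2 → (σ.move (lab N l₀ l₁ (res a N))).2 = l₀)
    (h₁ : (N + 1) % 2 = i % 2 → (σ.move (lab N l₀ l₁ (res a (N + 1)))).2 = l₁) :
    labSeq N l₀ l₁ a ∈ plays σ := by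
  refine ⟨fun n => ?_, fun n hp => ?_⟩
  · change res _ n ∈ _
    rw [res_labSeq]
    exact lab_mem_unravelTree.2 (hg n)
  · change _ = σ.move (res _ n)
    rw [res_labSeq]
    refine Prod.ext (hmove n hp).symm ?_
    change lbl N l₀ l₁ n = _
    by_cases hn : n = N
    · subst hn
      rw [h₀ hp, lbl_left]
    by_cases hn' : n = N + 1
    · subst hn'
      rw [h₁ hp, lbl_right]
    obtain ⟨m₀, m₁, -, h, -⟩ := exists_good_move (σ := σ) (hg n) (by simpa using hp)
    rw [h, length_res, lbl_other _ _ hn hn', lbl_other _ _ hn hn']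

end UnravelTree

section Lifting

variable {A : Type u} [Inhabited A]

open Classical in
/-- The moves of `σ` at positions of length at most `n`, with a default value elsewhere. -/
noncomputable def trunc {B : Type*} [Inhabited B] {S : Set (List B)} {i : ℕ} (σ : Strategy S i)
    (n : ℕ) (x : List B) : B :=
  if x ∈ S ∧ x.length ≤ n then σ.move x else default

lemma trunc_congr {B : Type*} [Inhabited B] {S : Set (List B)} {i n m : ℕ} {σ σ' : Strategy S i}
    (h : ∀ x ∈ S, x.length ≤ n → σ.move x = σ'.move x) (hm : m ≤ n) :
    trunc σ m = trunc σ' m := by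
  funext x
  unfold trunc
  split_ifs with hx
  · exact h x hx.1 (hx.2.trans hm)
  · rfl

open Classical in
/-- The move at `z` of the player who simulates `g` on the unraveling tree: once `z` has passed
through a position `u ∈ U`, use the labels `lU u`; before that, force `U` from the first position
from `ρ` on where this is possible; otherwise use the labels `lC`. -/
noncomputable def simMove (R : Set (List A)) (i : ℕ) (U : Set (List A)) (N ρ : ℕ)
    (lU : List A → Set (List A) × Set (List A)) (lC : Set (List A) × Set (List A))
    (g : List (A × Set (List A)) → A × Set (List A)) (z : List A) : A :=
  if ∃ n, z.take n ∈ U then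
    (g (lab N (lU (z.take (sInf {n | z.take n ∈ U}))).1
      (lU (z.take (sInf {n | z.take n ∈ U}))).2 z)).1
  else if ∃ n, ρ ≤ n ∧ Reach R i U (z.take n) then
    attackMove R i U (z.take (sInf {n | ρ ≤ n ∧ Reach R i U (z.take n)})) z
  else (g (lab N lC.1 lC.2 z)).1

section SimMove

variable {R U : Set (List A)} {i N ρ n : ℕ} {lU : List A → Set (List A) × Set (List A)}
  {lC : Set (List A) × Set (List A)} {g : List (A × Set (List A)) → A × Set (List A)} {a : ℕ → A}

lemma simMove_of_hit {k : ℕ} (h : res a k ∈ U) (hmin : ∀ j < k, res a j ∉ U) (hn : k ≤ n) :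
    simMove R i U N ρ lU lC g (res a n) =
      (g (lab N (lU (res a k)).1 (lU (res a k)).2 (res a n))).1 := by
  have hk : sInf {j | (res a n).take j ∈ U} = k := by
    refine IsLeast.csInf_eq ⟨?_, fun j hj => ?_⟩
    · simpa [take_res_of_le a hn] using h
    · by_contra! hlt
      refine hmin j hlt ?_
      rwa [Set.mem_ofPred_eq, take_res_of_le a (by omega)] at hj
  rw [simMove, if_pos ⟨k, by rwa [take_res_of_le a hn]⟩, hk, take_res_of_le a hn]

lemma simMove_of_reach (hU : ∀ k, res a k ∉ U) {m : ℕ} (hm : ρ ≤ m)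
    (h : Reach R i U (res a m)) (hmin : ∀ j, ρ ≤ j → j < m → ¬ Reach R i U (res a j))
    (hn : m ≤ n) :
    simMove R i U N ρ lU lC g (res a n) = attackMove R i U (res a m) (res a n) := by
  have hk : sInf {j | ρ ≤ j ∧ Reach R i U ((res a n).take j)} = m := by
    refine IsLeast.csInf_eq ⟨⟨hm, by rwa [take_res_of_le a hn]⟩, fun j hj => ?_⟩
    by_contra! hlt
    refine hmin j hj.1 hlt ?_
    have := hj.2
    rwa [take_res_of_le a (by omega)] at this
  rw [simMove, if_neg (by simpa [take_res] using fun x => hU _),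
    if_pos ⟨m, hm, by rwa [take_res_of_le a hn]⟩, hk, take_res_of_le a hn]

lemma simMove_of_safe (hU : ∀ k, res a k ∉ U) (hρ : ρ ≤ n)
    (h : ∀ j, ρ ≤ j → j ≤ n → ¬ Reach R i U (res a j)) :
    simMove R i U N ρ lU lC g (res a n) = (g (lab N lC.1 lC.2 (res a n))).1 := by
  rw [simMove, if_neg (by simpa [take_res] using fun x => hU _), if_neg]
  rintro ⟨j, hj, hr⟩
  rw [take_res] at hr
  exact h _ (le_min hj hρ) (min_le_right _ _) hr

end SimMove

/-- The positions of `Q` from `q` on that lie outside `D`. -/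
def escapes (D Q : Set (List A)) (q : List A) : Set (List A) := {u ∈ Q | q <+: u ∧ u ∉ D}

/-- If player `0` chooses the quasistrategy `Q` at the end of `r`, then `G` answers with the cone
of the position `u` of `Q` outside `D`. -/
structure IsWitness (T D : Set (List A)) (N : ℕ)
    (G : List (A × Set (List A)) → A × Set (List A)) (r u : List A) (Q : Set (List A)) :
    Prop where
  quasi : IsQuasi T Q 0 r
  mem : u ∈ Q
  notMem : u ∉ D
  answer : ∃ b, r ++ [b] <+: u ∧ G (lab N Q ∅ r) = (b, cone T u)

/-- The positions that `G` may announce in answer to some quasistrategy chosen at `r`. -/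
def announced (T D : Set (List A)) (N : ℕ)
    (G : List (A × Set (List A)) → A × Set (List A)) (r : List A) : Set (List A) :=
  {u | ∃ Q, IsWitness T D N G r u Q}

/-- The moves of player `0` after the position `N + 1`. -/
noncomputable def simMove₀ (T D : Set (List A)) (N : ℕ)
    (G g : List (A × Set (List A)) → A × Set (List A)) (z : List A) : A :=
  let Q := (G (lab N ∅ ∅ (z.take N))).2
  let U := escapes D Q (z.take (N + 2))
  simMove Q 0 U N (N + 2) (fun u => (Q, cone T u)) (Q, safe Q 0 U (z.take (N + 2))) g z

open Classical in
/-- The moves of player `1` after the position `N`. -/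
noncomputable def simMove₁ (T D : Set (List A)) (N : ℕ)
    (G g : List (A × Set (List A)) → A × Set (List A)) (z : List A) : A :=
  let r := z.take (N + 1)
  let U := announced T D N G r
  simMove T 1 U N (N + 1)
    (fun u => (if h : ∃ Q, IsWitness T D N G r u Q then h.choose else ∅, cone T u))
    (safe T 1 U r, (G (lab N (safe T 1 U r) ∅ r)).2) g z

variable {T D : Set (List A)} {N : ℕ}

/-- The move at `z` induced by a strategy on the unraveling tree. -/
noncomputable def inducedMove {i : ℕ} (σ : Strategy (unravelTree T D N) i) (z : List A) : A :=
  if z.length ≤ N then (trunc σ z.length (lab N ∅ ∅ z)).1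
  else if i % 2 = 0 then simMove₀ T D N (trunc σ (N + 1)) (trunc σ z.length) z
  else simMove₁ T D N (trunc σ (N + 1)) (trunc σ z.length) z

lemma inducedMove_congr {i n : ℕ} {σ σ' : Strategy (unravelTree T D N) i}
    (h : ∀ x ∈ unravelTree T D N, x.length ≤ n → σ.move x = σ'.move x) {z : List A}
    (hz : z.length ≤ n) : inducedMove σ z = inducedMove σ' z := by
  unfold inducedMove
  rw [trunc_congr h hz]
  split_ifs with hN
  · rfl
  · rw [trunc_congr h (m := N + 1) (by omega)]
  · rw [trunc_congr h (m := N + 1) (by omega)]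

variable {i : ℕ} {σ : Strategy (unravelTree T D N) i} {l₀ l₁ : Set (List A)}
  {a : ℕ → A}

lemma trunc_lab {y : List A} {n : ℕ} (h : Good T D N l₀ l₁ y) (hn : y.length ≤ n) :
    trunc σ n (lab N l₀ l₁ y) = σ.move (lab N l₀ l₁ y) := by
  rw [trunc, if_pos ⟨lab_mem_unravelTree.2 h, by simpa using hn⟩]

lemma eq_move_of_inducedMove (hpr : IsPruned T)
    (ha : a ∈ plays (Strategy.ofFun hpr i (inducedMove σ))) {n : ℕ}
    (hp : n % 2 = i % 2) (hg : Good T D N l₀ l₁ (res a n))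
    (h : inducedMove σ (res a n) = (trunc σ n (lab N l₀ l₁ (res a n))).1) :
    (σ.move (lab N l₀ l₁ (res a n))).1 = a n := by
  rw [trunc_lab hg (by simp)] at h
  obtain ⟨m₀, m₁, hg', -⟩ := exists_good_move (σ := σ) hg (by simpa using hp)
  have hc := ha.2 n hp
  change a n = Strategy.move _ (res a n) at hc
  rw [hc, Strategy.ofFun_move, h]
  rw [h]
  exact hg'.mem

lemma eq_move_of_le (hpr : IsPruned T)
    (ha : a ∈ plays (Strategy.ofFun hpr i (inducedMove σ))) {n : ℕ}
    (hp : n % 2 = i % 2) (hn : n ≤ N) (l₀ l₁ : Set (List A)) :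
    (σ.move (lab N l₀ l₁ (res a n))).1 = a n := by
  have hl : lab N l₀ l₁ (res a n) = lab N ∅ ∅ (res a n) :=
    lab_congr (fun h => absurd h (by simp; omega)) fun h => absurd h (by simp; omega)
  rw [hl]
  refine eq_move_of_inducedMove hpr ha hp (good_of_length_le (res_mem ha.1 n) (by simpa)) ?_
  rw [inducedMove, if_pos (by simpa), length_res]

lemma exists_lift_zero (hpr : IsPruned T) (hN : N % 2 = 0) (hi : i % 2 = 0)
    (ha : a ∈ plays (Strategy.ofFun hpr i (inducedMove σ))) :
    ∃ l₀ l₁, labSeq N l₀ l₁ a ∈ plays σ := by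
  have haT : a ∈ body T := ha.1
  have hgN : Good T D N ∅ ∅ (res a N) := good_of_length_le (res_mem haT N) (by simp)
  have hmN := eq_move_of_le hpr ha (hN.trans hi.symm) le_rfl ∅ ∅
  set Q := (σ.move (lab N ∅ ∅ (res a N))).2 with hQdef
  have hQ : IsQuasi T Q 0 (res a (N + 1)) := by
    obtain ⟨m₀, m₁, hg, h, -⟩ := exists_good_move (σ := σ) hgN (by simp; omega)
    rw [length_res, lbl_left, ← hQdef] at h
    have := hg.quasi (by simp)
    rwa [hmN, ← res_succ, take_res_of_le a le_rfl, ← h] at this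
  have hmoveN : ∀ l₀ l₁, (σ.move (lab N l₀ l₁ (res a N))).2 = Q := fun l₀ l₁ => by
    rw [hQdef, lab_congr (l₀' := ∅) (l₁' := ∅) (fun h => absurd h (by simp)) fun h =>
      absurd h (by simp)]
  have hQstep : ∀ n, N + 1 ≤ n → n % 2 = 1 → res a n ∈ Q → res a (n + 1) ∈ Q := by
    intro n hn hp h
    rw [res_succ]
    exact hQ.closed _ h (res_prefix a hn) (by simp; omega) _ (by
      rw [← res_succ]
      exact res_mem haT _)
  have hqQ : res a (N + 2) ∈ Q := hQstep _ le_rfl (by omega) hQ.root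
  set q := res a (N + 2) with hq
  set U := escapes D Q q with hU
  set C := safe Q 0 U q with hC
  have hind : ∀ n, N + 2 ≤ n → inducedMove σ (res a n) =
      simMove Q 0 U N (N + 2) (fun u => (Q, cone T u)) (Q, C) (trunc σ n) (res a n) := by
    intro n hn
    rw [inducedMove, if_neg (by simp; omega), if_pos hi, simMove₀, length_res,
      take_res_of_le a (by omega : N ≤ n), take_res_of_le a hn, trunc_lab hgN (by simp)]
  by_cases hhit : ∃ k, res a k ∈ U
  · classical
    obtain ⟨k, ⟨hkQ, hqk, hkD⟩, hmin⟩ : ∃ k, res a k ∈ U ∧ ∀ j < k, res a j ∉ U :=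
      ⟨Nat.find hhit, Nat.find_spec hhit, fun j hj => Nat.find_min hhit hj⟩
    have hg : ∀ n, Good T D N Q (cone T (res a k)) (res a n) := fun n =>
      good_res haT hQ (Or.inl ⟨_, hkQ, hqk, hkD, rfl⟩) fun _ => res_mem_cone haT k n
    refine ⟨Q, cone T (res a k), labSeq_mem_plays hg (fun n hp => ?_) (fun _ => hmoveN _ _)
      fun h => by omega⟩
    rcases Nat.lt_or_ge N n with hn | hn
    · have hn' : N + 1 < n := by omega
      rcases Nat.lt_or_ge n k with hk | hk
      · exact move_eq_of_cone (hg n) hn' hk hp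
      · refine eq_move_of_inducedMove hpr ha hp (hg n) ?_
        rw [hind n hn', simMove_of_hit (show res a k ∈ U from ⟨hkQ, hqk, hkD⟩) hmin hk]
    · exact eq_move_of_le hpr ha hp hn _ _
  · push Not at hhit
    have hgood : ¬ Reach Q 0 U q → ∀ n, (N + 1 < n → res a n ∈ C) → Good T D N Q C (res a n) := by
      intro hnr n h
      refine good_res haT hQ (Or.inr ⟨?_, fun y hy hqy => ?_⟩) h
      · exact isQuasi_safe hQ.tree hQ.pruned (by decide) hqQ hnr
      · by_contra hyD
        exact hy.2 y List.prefix_rfl hqy (reach_of_mem hQ.pruned ⟨hy.1, hqy, hyD⟩)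
    have hmemC : ∀ n, res a n ∈ Q →
        (∀ j, N + 2 ≤ j → j ≤ n → ¬ Reach Q 0 U (res a j)) → res a n ∈ C := by
      intro n hn h
      refine ⟨hn, fun z hz hqz => ?_⟩
      have hz' := hz.length_le
      have hqz' := hqz.length_le
      rw [length_res] at hz' hqz'
      rw [eq_res_of_prefix hz]
      exact h _ hqz' hz'
    have hmoveC : ¬ Reach Q 0 U q → ∀ n, N + 2 ≤ n → n % 2 = 0 →
        (∀ j, N + 2 ≤ j → j ≤ n → ¬ Reach Q 0 U (res a j)) → res a n ∈ C →
        (σ.move (lab N Q C (res a n))).1 = a n := by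
      intro hnr n hn hp h hC'
      refine eq_move_of_inducedMove hpr ha (by omega) (hgood hnr n fun _ => hC') ?_
      rw [hind n hn, simMove_of_safe hhit hn h]
    have hstepC : ∀ n, N + 2 ≤ n → (∀ j, N + 2 ≤ j → j ≤ n → ¬ Reach Q 0 U (res a j)) →
        res a n ∈ Q → res a (n + 1) ∈ Q := by
      intro n hn h hnQ
      have hnC := hmemC n hnQ h
      have hnr := h _ le_rfl hn
      rcases Nat.mod_two_eq_zero_or_one n with hp | hp
      · have := (good_move (σ := σ) (hgood hnr n fun _ => hnC) (by simp; omega)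
          (by simp; omega)).mem_right (by simp; omega)
        rw [hmoveC hnr n hn hp h hnC, ← res_succ] at this
        exact this.1
      · exact hQstep n (by omega) hp hnQ
    have hno : ∀ m, N + 2 ≤ m → ¬ Reach Q 0 U (res a m) := by
      by_contra! hex
      classical
      obtain ⟨m, ⟨hm, hr⟩, hmin⟩ : ∃ m, (N + 2 ≤ m ∧ Reach Q 0 U (res a m)) ∧
          ∀ j < m, ¬ (N + 2 ≤ j ∧ Reach Q 0 U (res a j)) :=
        ⟨Nat.find hex, Nat.find_spec hex, fun j hj => Nat.find_min hex hj⟩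
      have hattack : ∀ n, m ≤ n → n % 2 = 0 → res a n ∈ Q →
          a n = attackMove Q 0 U (res a m) (res a n) := by
        intro n hn hp hnQ
        have hsim := simMove_of_reach (N := N) (lU := fun u => (Q, cone T u)) (lC := (Q, C))
          (g := trunc σ n) hhit hm hr (fun j h h' h'' => hmin j h' ⟨h, h''⟩) hn
        rw [← hind n (hm.trans hn)] at hsim
        have hc := ha.2 n (by omega)
        change a n = Strategy.move _ (res a n) at hc
        rw [hc, Strategy.ofFun_move, hsim]
        rw [hsim]
        exact hQ.subset (attackMove_legal hr hnQ (by simpa using hp))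
      have hbody : ∀ n, N + 2 ≤ n → res a n ∈ Q := by
        intro n hn
        induction n, hn using Nat.le_induction with
        | base => exact hqQ
        | succ n hn ih =>
          rcases Nat.lt_or_ge n m with hnm | hnm
          · exact hstepC n hn (fun j h h' h'' => hmin j (by omega) ⟨h, h''⟩) ih
          · rcases Nat.mod_two_eq_zero_or_one n with hp | hp
            · rw [res_succ, hattack n hnm hp ih]
              exact attackMove_legal hr ih (by simpa using hp)
            · exact hQstep n (by omega) hp ih
      have hbQ : a ∈ body Q := fun n =>
        hQ.tree (res_prefix a (le_max_left n (N + 2))) (hbody _ (le_max_right _ _))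
      obtain ⟨k, hk⟩ := exists_mem_of_attack hbQ hr fun n hn hp =>
        hattack n hn hp (res_mem hbQ n)
      exact hhit k hk
    have hnr := hno _ le_rfl
    have hallQ : ∀ n, N + 2 ≤ n → res a n ∈ Q := by
      intro n hn
      induction n, hn using Nat.le_induction with
      | base => exact hqQ
      | succ n hn ih => exact hstepC n hn (fun j h _ => hno j h) ih
    have hallC : ∀ n, N + 2 ≤ n → res a n ∈ C := fun n hn =>
      hmemC n (hallQ n hn) fun j h _ => hno j h
    refine ⟨Q, C, labSeq_mem_plays (fun n => hgood hnr n (hallC n)) (fun n hp => ?_)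
      (fun _ => hmoveN _ _) fun h => by omega⟩
    rcases Nat.lt_or_ge N n with hn | hn
    · exact hmoveC hnr n (by omega) (by omega) (fun j h _ => hno j h) (hallC n (by omega))
    · exact eq_move_of_le hpr ha hp hn _ _

lemma exists_lift_one (hT : IsTree T) (hpr : IsPruned T) (hN : N % 2 = 0) (hi : i % 2 = 1)
    (ha : a ∈ plays (Strategy.ofFun hpr i (inducedMove σ))) :
    ∃ l₀ l₁, labSeq N l₀ l₁ a ∈ plays σ := by
  have haT : a ∈ body T := ha.1
  set r := res a (N + 1) with hr
  set G := trunc σ (N + 1) with hG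
  set U := announced T D N G r with hU
  set C := safe T 1 U r with hC
  have hgr : ∀ {Q l : Set (List A)}, IsQuasi T Q 0 r → Good T D N Q l r := fun hQ =>
    ⟨res_mem haT _, fun _ => by rwa [take_res_of_le a le_rfl], fun h => absurd h (by simp [hr]),
      fun h => absurd h (by simp [hr])⟩
  have hlabr : ∀ Q l : Set (List A), lab N Q l r = lab N Q ∅ r := fun Q l =>
    lab_congr (fun _ => rfl) fun h => absurd h (by simp [hr])
  have hGr : ∀ {Q : Set (List A)} (l : Set (List A)), IsQuasi T Q 0 r →
      G (lab N Q ∅ r) = σ.move (lab N Q l r) := fun {Q} l hQ => by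
    rw [hlabr Q l, hG, trunc_lab (hgr hQ) (by simp [hr])]
  have hind : ∀ n, N + 1 ≤ n → inducedMove σ (res a n) =
      simMove T 1 U N (N + 1)
        (fun u => (open Classical in if h : ∃ Q, IsWitness T D N G r u Q then h.choose else ∅,
          cone T u)) (C, (G (lab N C ∅ r)).2) (trunc σ n) (res a n) := by
    intro n hn
    rw [inducedMove, if_neg (by simp; omega), if_neg (by omega), simMove₁, length_res,
      take_res_of_le a hn]
  by_cases hhit : ∃ k, res a k ∈ U
  · classical
    obtain ⟨k, hk, hmin⟩ : ∃ k, res a k ∈ U ∧ ∀ j < k, res a j ∉ U :=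
      ⟨Nat.find hhit, Nat.find_spec hhit, fun j hj => Nat.find_min hhit hj⟩
    have hex : ∃ Q, IsWitness T D N G r (res a k) Q := hk
    set Q := hex.choose with hQdef
    obtain ⟨hQ, hkQ, hkD, b, hb, hans⟩ : IsWitness T D N G r (res a k) Q := hex.choose_spec
    have hlen := hb.length_le
    simp only [hr, List.length_append, length_res, List.length_singleton] at hlen
    have hb' : b = a (N + 1) := by
      have := eq_res_of_prefix hb
      rw [List.length_append, hr, length_res, List.length_singleton, res_succ a (N + 1)] at this
      simpa using this
    have hg : ∀ n, Good T D N Q (cone T (res a k)) (res a n) := fun n =>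
      good_res haT hQ (Or.inl ⟨_, hkQ, res_prefix a hlen, hkD, rfl⟩) fun _ => res_mem_cone haT k n
    rw [hGr (cone T (res a k)) hQ] at hans
    refine ⟨Q, cone T (res a k), labSeq_mem_plays hg (fun n hp => ?_) (fun h => by omega)
      fun _ => by rw [hans]⟩
    rcases Nat.lt_or_ge N n with hn | hn
    · rcases Nat.lt_or_ge (N + 1) n with hn' | hn'
      · rcases Nat.lt_or_ge n k with hk' | hk'
        · exact move_eq_of_cone (hg n) hn' hk' hp
        · refine eq_move_of_inducedMove hpr ha hp (hg n) ?_
          rw [hind n hn, simMove_of_hit hk hmin hk', dif_pos hex]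
      · obtain rfl : n = N + 1 := by omega
        rw [hans, hb']
    · exact eq_move_of_le hpr ha hp hn _ _
  · push Not at hhit
    have hno : ∀ m, N + 1 ≤ m → ¬ Reach T 1 U (res a m) := by
      by_contra! hex
      classical
      obtain ⟨m, ⟨hm, hr⟩, hmin⟩ : ∃ m, (N + 1 ≤ m ∧ Reach T 1 U (res a m)) ∧
          ∀ j < m, ¬ (N + 1 ≤ j ∧ Reach T 1 U (res a j)) :=
        ⟨Nat.find hex, Nat.find_spec hex, fun j hj => Nat.find_min hex hj⟩
      obtain ⟨k, hk⟩ := exists_mem_of_attack haT hr fun n hn hp => by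
        have hsim := hind n (hm.trans hn)
        rw [simMove_of_reach hhit hm hr (fun j h h' h'' => hmin j h' ⟨h, h''⟩) hn] at hsim
        have hc := ha.2 n (by omega)
        change a n = Strategy.move _ (res a n) at hc
        rw [hc, Strategy.ofFun_move, hsim]
        rw [hsim]
        exact attackMove_legal hr (res_mem haT n) (by simpa using hp)
      exact hhit k hk
    have hallC : ∀ n, res a n ∈ C := by
      refine fun n => ⟨res_mem haT n, fun z hz hrz => ?_⟩
      have hrz' := hrz.length_le
      rw [length_res] at hrz'
      rw [eq_res_of_prefix hz]
      exact hno _ hrz'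
    have hCq : IsQuasi T C 0 r := isQuasi_safe hT hpr (by decide) (res_mem haT _) (hno _ le_rfl)
    set Λ := (G (lab N C ∅ r)).2 with hΛ
    have hmove : ∀ n, N + 1 ≤ n → n % 2 = 1 → Good T D N C Λ (res a n) →
        (σ.move (lab N C Λ (res a n))).1 = a n := by
      intro n hn hp hg
      refine eq_move_of_inducedMove hpr ha (by omega) hg ?_
      rw [hind n hn, simMove_of_safe hhit hn fun j h _ => hno j h]
    have hmover := hmove _ le_rfl (by omega) (hgr hCq)
    have hΛ' : (σ.move (lab N C Λ r)).2 = Λ := by rw [← hGr Λ hCq]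
    have hlegit : Legit T D C Λ (res a (N + 2)) := by
      obtain ⟨m₀, m₁, hg, hm, h₀, -⟩ := exists_good_move (σ := σ) (hgr (l := Λ) hCq)
        (by simp [hr]; omega)
      have hlen : r.length = N + 1 := length_res _ _
      rw [hΛ', hlen, lbl_right] at hm
      rw [hmover, ← res_succ] at hg
      have := hg.legit (by simp)
      rwa [take_res_of_le a le_rfl, ← hm, h₀ (by omega)] at this
    have hquasi : IsQuasi C Λ 1 (res a (N + 2)) := by
      rcases hlegit with ⟨u, huC, hqu, huD, hcone⟩ | ⟨h, -⟩
      · exfalso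
        have hru : r <+: u := (res_prefix a (by omega)).trans hqu
        refine huC.2 u List.prefix_rfl hru (reach_of_mem hpr ⟨C, hCq, huC, huD, a (N + 1), ?_, ?_⟩)
        · rwa [hr, ← res_succ]
        · rw [hGr Λ hCq]
          exact Prod.ext hmover (hΛ'.trans hcone)
      · exact h
    have hallΛ : ∀ n, N + 2 ≤ n → res a n ∈ Λ := by
      intro n hn
      induction n, hn using Nat.le_induction with
      | base => exact hquasi.root
      | succ n hn ih =>
        rcases Nat.mod_two_eq_zero_or_one n with hp | hp
        · rw [res_succ]
          exact hquasi.closed _ ih (res_prefix a hn) (by simp; omega) _ (by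
            rw [← res_succ]
            exact hallC _)
        · have hg := good_res (N := N) haT hCq hlegit (n := n) fun _ => ih
          have := (good_move (σ := σ) hg (by simp; omega) (by simp; omega)).mem_right
            (by simp; omega)
          rwa [hmove n (by omega) hp hg, ← res_succ] at this
    have hg : ∀ n, Good T D N C Λ (res a n) := fun n =>
      good_res haT hCq hlegit fun h => hallΛ n h
    refine ⟨C, Λ, labSeq_mem_plays hg (fun n hp => ?_) (fun h => by omega) fun _ => hΛ'⟩
    rcases Nat.lt_or_ge N n with hn | hn
    · exact hmove n hn (by omega) (hg n)
    · exact eq_move_of_le hpr ha hp hn _ _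

end Lifting

section Unraveling

variable {A : Type u}

/-- `P` is closed in the body of `T`, in terms of sequences. -/
def SeqClosed (T : Set (List A)) (P : Set (ℕ → A)) : Prop :=
  ∀ a ∈ body T, (∀ n, ∃ b ∈ body T, b ∈ P ∧ res b n = res a n) → a ∈ P

lemma seqClosed_of_isClosed {T : Set (List A)} {P : Set (ℕ → A)}
    (hP : @IsClosed _ (bodyTop T) {a : {a // a ∈ body T} | a.1 ∈ P}) : SeqClosed T P := by
  intro a ha h
  let _ : TopologicalSpace A := ⊥
  have : DiscreteTopology A := ⟨rfl⟩
  choose b hb hbP hres using h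
  let s : ℕ → {a // a ∈ body T} := fun n => ⟨b n, hb n⟩
  have hlim : Filter.Tendsto s Filter.atTop (nhds ⟨a, ha⟩) := by
    rw [tendsto_subtype_rng, tendsto_pi_nhds]
    intro i
    refine tendsto_const_nhds.congr' ?_
    filter_upwards [Filter.eventually_gt_atTop i] with n hn
    exact (res_congr.1 (hres n) i hn).symm
  have hP' : IsClosed {a : {a // a ∈ body T} | a.1 ∈ P} := hP
  exact hP'.mem_of_tendsto hlim (Filter.Eventually.of_forall hbP)

/-- A set of branches whose membership depends on finitely many entries is clopen. -/
lemma isClopen_of_res {S : Set (List A)} (X : Set {a // a ∈ body S}) (n : ℕ)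
    (h : ∀ a b : {a // a ∈ body S}, res a.1 n = res b.1 n → a ∈ X → b ∈ X) :
    @IsClopen _ (bodyTop S) X := by
  let _ : TopologicalSpace A := ⊥
  have : DiscreteTopology A := ⟨rfl⟩
  have key : ∀ Y : Set {a // a ∈ body S},
      (∀ a b : {a // a ∈ body S}, res a.1 n = res b.1 n → a ∈ Y → b ∈ Y) → IsOpen Y := by
    intro Y hY
    rw [isOpen_iff_mem_nhds]
    intro a ha
    have hev : ∀ᶠ b : {a // a ∈ body S} in nhds a, ∀ i ∈ Finset.range n, a.1 i = b.1 i := by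
      rw [Filter.eventually_all_finset]
      intro i _
      have hc : Continuous fun b : {a // a ∈ body S} => b.1 i :=
        (continuous_apply i).comp continuous_subtype_val
      have : {b : {a // a ∈ body S} | b.1 i = a.1 i} ∈ nhds a :=
        ((isOpen_discrete {a.1 i}).preimage hc).mem_nhds rfl
      filter_upwards [this] with b hb using hb.symm
    filter_upwards [hev] with b hb
    exact hY a b (res_congr.2 fun i hi => hb i (Finset.mem_range.2 hi)) ha
  have hX : IsClopen X := by
    refine ⟨⟨key _ fun a b hab ha hb => ha (h b a hab.symm hb)⟩, key X h⟩
  exact hX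

lemma res_bodyMap {B : Type u} [Inhabited B] {S : Set (List A)} {T : Set (List B)}
    (f : TreeHom S T) {a : ℕ → A} (ha : a ∈ body S) (n : ℕ) :
    res (bodyMap f.toFun a) n = f.toFun (res a n) := by
  apply List.ext_getElem
  · rw [length_res, f.len _ (res_mem ha n), length_res]
  · intro i h₁ h₂
    rw [length_res] at h₁
    have hl : (f.toFun (res a (i + 1))).length = i + 1 := by
      rw [f.len _ (res_mem ha _), length_res]
    have hpre := f.mono (res_mem ha (i + 1)) (res_mem ha n) (res_prefix a h₁)
    rw [getElem_res, ← hpre.getElem (by omega)]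
    exact List.getD_eq_getElem _ _ (by change i < (f.toFun (res a (i + 1))).length; omega)

lemma bodyMap_mem {B : Type u} [Inhabited B] {S : Set (List A)} {T : Set (List B)}
    (f : TreeHom S T) {a : ℕ → A} (ha : a ∈ body S) : bodyMap f.toFun a ∈ body T := fun n => by
  change res _ n ∈ T
  rw [res_bodyMap f ha]
  exact f.mem _ (res_mem ha n)

lemma SeqClosed.preimage {B : Type u} [Inhabited B] {S : Set (List A)} {T : Set (List B)}
    {P : Set (ℕ → B)} (hP : SeqClosed T P) (f : TreeHom S T) :
    SeqClosed S (bodyMap f.toFun ⁻¹' P) := by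
  intro a ha h
  refine hP _ (bodyMap_mem f ha) fun n => ?_
  obtain ⟨b, hb, hbP, hres⟩ := h n
  exact ⟨_, bodyMap_mem f hb, hbP, by rw [res_bodyMap f hb, res_bodyMap f ha, hres]⟩

/-- The positions from which some branch in `P` starts. -/
def positions (T : Set (List A)) (P : Set (ℕ → A)) : Set (List A) :=
  {y | ∃ b ∈ body T, b ∈ P ∧ res b y.length = y}

lemma positions_of_prefix {T : Set (List A)} {P : Set (ℕ → A)} {x y : List A} (h : x <+: y)
    (hy : y ∈ positions T P) : x ∈ positions T P := by
  obtain ⟨b, hb, hbP, hres⟩ := hy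
  rw [← hres] at h
  exact ⟨b, hb, hbP, (eq_res_of_prefix h).symm⟩

variable {T : Set (List A)} {P : Set (ℕ → A)} {N : ℕ} {l₀ l₁ : Set (List A)}

lemma mem_iff_of_good (hP : SeqClosed T P) {a : ℕ → A}
    (hg : ∀ n, Good T (positions T P) N l₀ l₁ (res a n)) :
    a ∈ P ↔ ∀ y ∈ l₁, res a (N + 2) <+: y → y ∈ positions T P := by
  have haT : a ∈ body T := fun n => (hg n).mem
  constructor
  · intro haP
    have hl := (hg (N + 2)).legit (by simp)
    rw [take_res_of_le a le_rfl] at hl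
    rcases hl with ⟨u, huQ, hqu, huD, rfl⟩ | ⟨-, h⟩
    · exfalso
      have hlen := hqu.length_le
      rw [length_res] at hlen
      have hmem := (hg u.length).mem_right (by simp; omega)
      have hu : res a u.length = u := by
        rcases hmem.2 with h | h
        · exact h.eq_of_length (by simp)
        · exact (h.eq_of_length (by simp)).symm
      exact huD ⟨a, haT, haP, hu⟩
    · exact h
  · intro h
    refine hP a haT fun n => ?_
    have hm := h _ ((hg (max n (N + 2))).mem_right (by simp)) (res_prefix a (le_max_right _ _))
    obtain ⟨b, hb, hbP, hres⟩ := positions_of_prefix (res_prefix a (le_max_left n (N + 2))) hm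
    exact ⟨b, hb, hbP, by simpa using hres⟩

/-- The tree morphism forgetting the labels. -/
def forget (T D : Set (List A)) (N : ℕ) : TreeHom (unravelTree T D N) T where
  toFun := List.map Prod.fst
  mem := by
    rintro _ ⟨l₀, l₁, y, rfl, hg⟩
    simpa using hg.mem
  len x _ := List.length_map _
  mono _ _ _ _ h := h.map _

variable [Inhabited A]

lemma bodyMap_forget (D : Set (List A)) (a : ℕ → A × Set (List A)) :
    bodyMap (forget T D N).toFun a = fun n => (a n).1 := by
  funext n
  change (List.map Prod.fst (res a (n + 1))).getD n default = _
  rw [List.getD_eq_getElem _ _ (by simp), List.getElem_map, getElem_res]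

/-- The unraveling covering of a closed game. -/
noncomputable def unravelCovering (T D : Set (List A)) (hT : IsTree T) (hpr : IsPruned T)
    (hN : N % 2 = 0) : Covering (unravelTree T D N) T where
  π := forget T D N
  φ i σ := Strategy.ofFun hpr i (inducedMove σ)
  agree i n σ σ' h x _ hl :=
    Strategy.ofFun_move_congr hpr i (inducedMove_congr h hl)
  lift i σ a ha := by
    obtain ⟨l₀, l₁, h⟩ : ∃ l₀ l₁, labSeq N l₀ l₁ a ∈ plays σ := by
      rcases Nat.mod_two_eq_zero_or_one i with hi | hi
      · exact exists_lift_zero hpr hN hi ha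
      · exact exists_lift_one hT hpr hN hi ha
    exact ⟨_, h, bodyMap_forget D _⟩

lemma isFixing_unravelCovering (D : Set (List A)) (hT : IsTree T) (hpr : IsPruned T)
    (hN : N % 2 = 0) {k : ℕ} (hk : k ≤ N) : IsFixing k (unravelCovering T D hT hpr hN) where
  bij := by
    constructor
    · rintro ⟨_, ⟨l₀, l₁, y, rfl, hg⟩, hl⟩ ⟨_, ⟨m₀, m₁, w, rfl, hg'⟩, hl'⟩ h
      have hyw : (lab N l₀ l₁ y).map Prod.fst = (lab N m₀ m₁ w).map Prod.fst :=
        congrArg Subtype.val h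
      rw [map_fst_lab, map_fst_lab] at hyw
      subst hyw
      rw [length_lab] at hl
      exact Subtype.ext (lab_congr (fun h => absurd h (by omega)) fun h => absurd h (by omega))
    · rintro ⟨y, hy, hl⟩
      exact ⟨⟨lab N ∅ ∅ y, lab_mem_unravelTree.2 (good_of_length_le hy (hl.trans hk)),
        by simpa using hl⟩, Subtype.ext (map_fst_lab y)⟩
  induced := by
    rintro i σ _ ⟨l₀, l₁, y, rfl, hg⟩ hl hp
    rw [length_lab] at hl hp
    obtain ⟨m₀, m₁, hg', -⟩ := exists_good_move (σ := σ) hg hp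
    have hind : inducedMove σ y = (σ.move (lab N l₀ l₁ y)).1 := by
      rw [inducedMove, if_pos (by omega), lab_congr (l₀' := l₀) (l₁' := l₁)
        (fun h => absurd h (by omega)) fun h => absurd h (by omega), trunc_lab hg le_rfl]
    change List.map Prod.fst (_ ++ _) = List.map Prod.fst _ ++
      [(Strategy.ofFun hpr i (inducedMove σ)).move (List.map Prod.fst _)]
    rw [List.map_append, map_fst_lab, Strategy.ofFun_move, hind]
    · rfl
    · rw [hind]
      exact hg'.mem

lemma unravelable_of_seqClosed (hT : IsTree T) (hpr : IsPruned T) (hne : T.Nonempty)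
    (hP : SeqClosed T P) : Unravelable T P := by
  intro k
  have hN : 2 * k % 2 = 0 := by omega
  refine ⟨_, unravelTree T (positions T P) (2 * k), unravelCovering T _ hT hpr hN,
    isTree_unravelTree hT, isPruned_unravelTree hT hpr hN, ?_,
    isFixing_unravelCovering _ hT hpr hN (by omega), ?_⟩
  · obtain ⟨y, hy⟩ := hne
    exact ⟨_, ∅, ∅, [], rfl, good_of_length_le (hT List.nil_prefix hy) (Nat.zero_le _)⟩
  · refine isClopen_of_res _ (2 * k + 2) fun a b hab ha => ?_
    change bodyMap (forget T _ _).toFun a.1 ∈ P at ha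
    change bodyMap (forget T _ _).toFun b.1 ∈ P
    rw [bodyMap_forget, mem_iff_of_good hP (good_of_mem_body a.2)] at ha
    rw [bodyMap_forget, mem_iff_of_good hP (good_of_mem_body b.2)]
    have hab' := res_congr.1 hab
    rw [← hab' (2 * k + 1) (by omega)]
    have : res (fun n => (b.1 n).1) (2 * k + 2) = res (fun n => (a.1 n).1) (2 * k + 2) :=
      res_congr.2 fun i hi => by rw [hab' i hi]
    rwa [this]

end Unraveling

/-- Closed games are universally unravelable. -/
theorem closed_univUnravelable {A : Type u} [Inhabited A] (T : Set (List A)) (P : Set (ℕ → A))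
    (hT : IsTree T) (hpr : IsPruned T) (hne : T.Nonempty)
    (hP : @IsClosed _ (bodyTop T) {a : {a // a ∈ body T} | a.1 ∈ P}) :
    UnivUnravelable T P := by
  intro B _ S c hS hSp hSne
  exact unravelable_of_seqClosed hS hSp hSne ((seqClosed_of_isClosed hP).preimage c.π)
end GS
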